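/- Let α ∈ [1/2, 1] and θ ∈ ℝ. Define the single-sample plug-in relative regret R₁(θ,γ) = 1 − γ·(1 − E_{X∼F_θ}[R(θ,γ,S*(X,γ))]), corresponding to skipping the first observation X, estimating the location parameter by θ̂ = X, and thereafter using the threshold S*(X,γ). Then R₁(θ,γ) → 0 as γ → 1⁻. -/

import Mathlib

open MeasureTheory Filter Set Topology

/-- Normalization constant `C₀ = (∫ exp(-|x|^α) dx)⁻¹`. -/
noncomputable def C0 (α : ℝ) : ℝ := (∫ x : ℝ, Real.exp (-(|x| ^ α)))⁻¹

/-- Density `f_θ(x) = C₀ exp(-|x-θ|^α)`. -/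
noncomputable def fd (α θ x : ℝ) : ℝ := C0 α * Real.exp (-(|x - θ| ^ α))

/-- Tail probability `P_θ(S) = ∫_S^∞ f_θ(x) dx`. -/
noncomputable def Ptail (α θ S : ℝ) : ℝ := ∫ x in Set.Ioi S, fd α θ x

/-- Conditional mean above `S`: `μ_θ(S) = (∫_S^∞ x f_θ(x) dx) / P_θ(S)`. -/
noncomputable def muTail (α θ S : ℝ) : ℝ := (∫ x in Set.Ioi S, x * fd α θ x) / Ptail α θ S

/-- `g_θ(S) = P_θ(S) / ∫_S^∞ P_θ(x) dx`. -/
noncomputable def gfun (α θ S : ℝ) : ℝ := Ptail α θ S / ∫ x in Set.Ioi S, Ptail α θ x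

/-- Hazard rate `h_θ(S) = f_θ(S)/P_θ(S)`. -/
noncomputable def hazard (α θ S : ℝ) : ℝ := fd α θ S / Ptail α θ S

/-- Value of the threshold policy with threshold `S` under parameter `θ`:
`V_{θ,γ}(S) = μ_θ(S)·P_θ(S)/((1−γ) + γ·P_θ(S))`. -/
noncomputable def Vfun (α θ γ S : ℝ) : ℝ :=
  muTail α θ S * Ptail α θ S / ((1 - γ) + γ * Ptail α θ S)

/-- Critical perturbation magnitude `ε_critical(γ)`. -/
noncomputable def epsCrit (α γ : ℝ) : ℝ :=
  Real.log (Real.log (1/(1-γ))) / (α * (Real.log (1/(1-γ))) ^ (1 - 1/α))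

lemma integrable_abs_rpow_mul_exp_neg_abs_rpow {a q : ℝ} (ha : 0 < a) (hq : 0 ≤ q) :
    Integrable fun x : ℝ => |x| ^ q * Real.exp (-(|x| ^ a)) := by
  have h := integrable_fun_norm_addHaar (volume : Measure ℝ)
    (f := fun y => y ^ q * Real.exp (-(y ^ a)))
  simp only [Real.norm_eq_abs, Module.finrank_self, Nat.sub_self, pow_zero, one_smul] at h
  rw [h]
  refine Integrable.of_integral_ne_zero ?_
  rw [integral_rpow_mul_exp_neg_rpow ha (by linarith)]
  have := Real.Gamma_pos_of_pos (show 0 < (q + 1) / a by positivity)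
  positivity

lemma integrable_exp_neg_abs_rpow {a : ℝ} (ha : 0 < a) :
    Integrable fun x : ℝ => Real.exp (-(|x| ^ a)) := by
  simpa using integrable_abs_rpow_mul_exp_neg_abs_rpow ha le_rfl

lemma C0_pos {α : ℝ} (ha : 0 < α) : 0 < C0 α :=
  inv_pos.2 (integral_exp_pos (integrable_exp_neg_abs_rpow ha))

lemma fd_pos {α : ℝ} (ha : 0 < α) (θ y : ℝ) : 0 < fd α θ y :=
  mul_pos (C0_pos ha) (Real.exp_pos _)

lemma fd_eq_fd_zero_sub (α θ y : ℝ) : fd α θ y = fd α 0 (y - θ) := by simp [fd]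

lemma integrable_fd {α : ℝ} (ha : 0 < α) (θ : ℝ) : Integrable (fd α θ) :=
  ((integrable_exp_neg_abs_rpow ha).const_mul (C0 α)).comp_sub_right θ

lemma integrable_sub_mul_fd {α : ℝ} (ha : 0 < α) (θ S : ℝ) :
    Integrable fun y => (y - S) * fd α θ y := by
  have h : Integrable fun y : ℝ => y * fd α 0 y := by
    refine ((integrable_abs_rpow_mul_exp_neg_abs_rpow ha zero_le_one).const_mul (C0 α)).mono
      ((continuous_id.aestronglyMeasurable).mul (integrable_fd ha 0).1) (ae_of_all _ fun y => ?_)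
    simp [fd, mul_left_comm]
  refine ((h.comp_sub_right θ).add ((integrable_fd ha θ).const_mul (θ - S))).congr
    (ae_of_all _ fun y => ?_)
  simp only [Pi.add_apply, ← fd_eq_fd_zero_sub]
  ring

/-- The expected excess `E[(X - S)⁺]` of `X ∼ F_θ` over the threshold `S`. -/
noncomputable def excess (α θ S : ℝ) : ℝ := ∫ y in Ioi S, (y - S) * fd α θ y

lemma setIntegral_Ioi_pos_of_pos {f : ℝ → ℝ} {S : ℝ} (hf : Integrable f)
    (h : ∀ y ∈ Ioi S, 0 < f y) : 0 < ∫ y in Ioi S, f y := by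
  rw [setIntegral_pos_iff_support_of_nonneg_ae
    ((ae_restrict_iff' measurableSet_Ioi).2 (ae_of_all _ fun y hy => (h y hy).le)) hf.integrableOn]
  rw [inter_eq_self_of_subset_right (show Ioi S ⊆ Function.support f from
    fun y hy => (h y hy).ne')]
  simp

lemma Ptail_pos {α : ℝ} (ha : 0 < α) (θ S : ℝ) : 0 < Ptail α θ S :=
  setIntegral_Ioi_pos_of_pos (integrable_fd ha θ) fun y _ => fd_pos ha θ y

lemma excess_pos {α : ℝ} (ha : 0 < α) (θ S : ℝ) : 0 < excess α θ S :=
  setIntegral_Ioi_pos_of_pos (integrable_sub_mul_fd ha θ S)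
    fun y hy => mul_pos (sub_pos.2 hy) (fd_pos ha θ y)

lemma setIntegral_Ioi_sub_mul_fd_le_excess {α : ℝ} (ha : 0 < α) (θ s S : ℝ) :
    ∫ y in Ioi S, (y - s) * fd α θ y ≤ excess α θ s := by
  rw [excess, ← integral_indicator measurableSet_Ioi, ← integral_indicator measurableSet_Ioi]
  refine integral_mono ((integrable_sub_mul_fd ha θ s).indicator measurableSet_Ioi)
    ((integrable_sub_mul_fd ha θ s).indicator measurableSet_Ioi) fun y => ?_
  have := fd_pos ha θ y
  simp only [indicator, mem_Ioi]
  split_ifs <;> nlinarith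

lemma setIntegral_Ioi_id_mul_fd {α : ℝ} (ha : 0 < α) (θ s S : ℝ) :
    ∫ y in Ioi S, y * fd α θ y = (∫ y in Ioi S, (y - s) * fd α θ y) + s * Ptail α θ S := by
  rw [Ptail, ← integral_const_mul, ← integral_add (integrable_sub_mul_fd ha θ s).integrableOn
    ((integrable_fd ha θ).const_mul s).integrableOn]
  congr with y
  ring

lemma excess_antitone {α : ℝ} (ha : 0 < α) (θ : ℝ) : Antitone (excess α θ) := by
  intro s t hst
  refine le_trans ?_ (setIntegral_Ioi_sub_mul_fd_le_excess ha θ s t)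
  refine integral_mono (integrable_sub_mul_fd ha θ t).integrableOn
    (integrable_sub_mul_fd ha θ s).integrableOn fun y => ?_
  exact mul_le_mul_of_nonneg_right (by linarith) (fd_pos ha θ y).le

lemma setIntegral_Ioi_comp_sub (f : ℝ → ℝ) (θ S : ℝ) :
    ∫ y in Ioi S, f (y - θ) = ∫ y in Ioi (S - θ), f y := by
  rw [← integral_indicator measurableSet_Ioi, ← integral_indicator measurableSet_Ioi,
    ← integral_sub_right_eq_self ((Ioi (S - θ)).indicator f) θ]
  congr with y
  simp [indicator]

lemma excess_eq_excess_zero_sub (α θ S : ℝ) : excess α θ S = excess α 0 (S - θ) := by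
  rw [excess, excess, ← setIntegral_Ioi_comp_sub]
  simp [fd_eq_fd_zero_sub α θ]

lemma Ptail_eq_Ptail_zero_sub (α θ S : ℝ) : Ptail α θ S = Ptail α 0 (S - θ) := by
  rw [Ptail, Ptail, ← setIntegral_Ioi_comp_sub]
  simp [fd_eq_fd_zero_sub α θ]

lemma integral_Ptail_eq_excess {α : ℝ} (ha : 0 < α) (θ S : ℝ) :
    ∫ x in Ioi S, Ptail α θ x = excess α θ S := by
  have hd : ∀ g : ℝ → ℝ, ∀ T, MeasurableSet T →
      ∫ y in T, g y ∂(volume.withDensity fun x => ENNReal.ofReal (fd α θ x)) =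
        ∫ y in T, g y * fd α θ y := fun g T hT => by
    rw [setIntegral_withDensity_eq_setIntegral_toReal_smul₀
      (integrable_fd ha θ).1.aemeasurable.ennreal_ofReal.restrict (by simp) _ hT]
    refine setIntegral_congr_fun hT fun y _ => ?_
    simp [ENNReal.toReal_ofReal (fd_pos ha θ y).le, mul_comm]
  set μ := volume.withDensity fun x => ENNReal.ofReal (fd α θ x) with hμ
  have hint : Integrable (fun y => y - S) (μ.restrict (Ioi S)) := by
    refine Integrable.integrableOn ?_
    rw [hμ, integrable_withDensity_iff_integrable_smul₀'
      (integrable_fd ha θ).1.aemeasurable.ennreal_ofReal (by simp)]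
    refine (integrable_sub_mul_fd ha θ S).congr (ae_of_all _ fun y => ?_)
    simp [ENNReal.toReal_ofReal (fd_pos ha θ y).le, mul_comm]
  have hlc := hint.integral_eq_integral_meas_lt
    ((ae_restrict_iff' measurableSet_Ioi).2 (ae_of_all _ fun y hy => sub_nonneg.2 (le_of_lt hy)))
  rw [excess, ← hd _ _ measurableSet_Ioi, hlc]
  have := setIntegral_Ioi_comp_sub (fun t => Ptail α θ (t + S)) S S
  simp only [sub_add_cancel, sub_self] at this
  rw [this]
  refine setIntegral_congr_fun measurableSet_Ioi fun t ht => ?_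
  have hset : {y : ℝ | t < y - S} = Ioi (t + S) := by
    ext y; simp [lt_sub_iff_add_lt]
  have hsub : Ioi (t + S) ∩ Ioi S = Ioi (t + S) :=
    inter_eq_self_of_subset_left (Ioi_subset_Ioi (by simpa using (le_of_lt ht)))
  have h1 := hd (fun _ => 1) (Ioi (t + S)) measurableSet_Ioi
  simp only [one_mul, integral_const, smul_eq_mul, mul_one] at h1
  rw [hset, Ptail, ← h1, measureReal_restrict_apply measurableSet_Ioi, hsub]
  simp

lemma fd_le_mul_fd {α : ℝ} (ha : 0 < α) (hα1 : α ≤ 1) (θ x y : ℝ) :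
    fd α x y ≤ Real.exp (|x - θ| ^ α) * fd α θ y := by
  have h1 : |y - θ| ^ α ≤ |y - x| ^ α + |x - θ| ^ α :=
    (Real.rpow_le_rpow (abs_nonneg _) (abs_sub_le y x θ) ha.le).trans
      (Real.rpow_add_le_add_rpow (abs_nonneg _) (abs_nonneg _) ha.le hα1)
  rw [fd, fd, mul_left_comm, ← Real.exp_add]
  exact mul_le_mul_of_nonneg_left (Real.exp_le_exp.2 (by linarith)) (C0_pos ha).le

lemma excess_le_mul_excess {α : ℝ} (ha : 0 < α) (hα1 : α ≤ 1) (θ x S : ℝ) :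
    excess α x S ≤ Real.exp (|x - θ| ^ α) * excess α θ S := by
  rw [excess, excess, ← integral_const_mul]
  refine setIntegral_mono_on (integrable_sub_mul_fd ha x S).integrableOn
    ((integrable_sub_mul_fd ha θ S).const_mul _).integrableOn measurableSet_Ioi fun y hy => ?_
  rw [mul_left_comm]
  exact mul_le_mul_of_nonneg_left (fd_le_mul_fd ha hα1 θ x y) (sub_nonneg.2 (le_of_lt hy))

lemma tendsto_rpow_mul_exp_neg_rpow_atTop {a : ℝ} (ha : 0 < a) (q : ℝ) :
    Tendsto (fun x : ℝ => x ^ q * Real.exp (-(x ^ a))) atTop (𝓝 0) := by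
  refine ((tendsto_rpow_mul_exp_neg_mul_atTop_nhds_zero (q / a) 1 one_pos).comp
    (tendsto_rpow_atTop ha)).congr' ?_
  filter_upwards [eventually_gt_atTop 0] with x hx
  simp [← Real.rpow_mul hx.le, mul_div_cancel₀ q ha.ne']

lemma mul_excess_zero_le {α : ℝ} (ha : 0 < α) {s : ℝ} (hs : 0 < s) :
    (α * s ^ α - 2) * excess α 0 s ≤ s * Ptail α 0 s := by
  have hI : ∀ q : ℝ, 0 ≤ q → IntegrableOn (fun y : ℝ => y ^ q * Real.exp (-(y ^ α))) (Ioi s) :=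
    fun q hq => (integrable_abs_rpow_mul_exp_neg_abs_rpow ha hq).integrableOn.congr_fun
      (fun y hy => by simp [abs_of_pos (hs.trans hy)]) measurableSet_Ioi
  have hint : IntegrableOn (fun y : ℝ =>
      ((y - s) * (α * y ^ α) - 2 * (y - s) - s) * Real.exp (-(y ^ α))) (Ioi s) := by
    refine IntegrableOn.congr_fun ((((hI (1 + α) (by positivity)).const_mul α).sub
      ((hI α ha.le).const_mul (s * α))).add (((hI 1 zero_le_one).const_mul (-2)).add
      ((hI 0 le_rfl).const_mul s))) (fun y hy => ?_) measurableSet_Ioi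
    simp only [Pi.add_apply, Pi.sub_apply, Real.rpow_add (hs.trans hy), Real.rpow_one,
      Real.rpow_zero]
    ring
  have hderiv : ∀ y ∈ Ici s, HasDerivAt (fun y : ℝ => -(y * (y - s)) * Real.exp (-(y ^ α)))
      (((y - s) * (α * y ^ α) - 2 * (y - s) - s) * Real.exp (-(y ^ α))) y := by
    intro y hy
    have hy0 : 0 < y := hs.trans_le hy
    have h1 := ((hasDerivAt_id y).mul ((hasDerivAt_id y).sub_const s)).neg.mul
      ((Real.hasDerivAt_rpow_const (p := α) (Or.inl hy0.ne')).neg.exp)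
    refine h1.congr_deriv ?_
    have h2 : y * y ^ (α - 1) = y ^ α := by
      rw [Real.rpow_sub_one hy0.ne']; field_simp
    simp only [id, Pi.neg_apply, Pi.mul_apply]
    rw [← h2]
    ring
  have hlim : Tendsto (fun y : ℝ => -(y * (y - s)) * Real.exp (-(y ^ α))) atTop (𝓝 0) := by
    have h := ((tendsto_rpow_mul_exp_neg_rpow_atTop ha 1).const_mul s).sub
      (tendsto_rpow_mul_exp_neg_rpow_atTop ha 2)
    simp only [mul_zero, sub_zero, Real.rpow_one, Real.rpow_two] at h
    refine h.congr fun y => ?_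
    ring
  have hzero := integral_Ioi_of_hasDerivAt_of_tendsto' hderiv hint hlim
  simp only [sub_self, mul_zero, neg_zero, zero_mul] at hzero
  have hle : (∫ y in Ioi s, ((α * s ^ α - 2) * ((y - s) * fd α 0 y) - s * fd α 0 y)) ≤
      ∫ y in Ioi s, C0 α * (((y - s) * (α * y ^ α) - 2 * (y - s) - s) * Real.exp (-(y ^ α))) := by
    refine setIntegral_mono_on ((((integrable_sub_mul_fd ha 0 s).const_mul _).sub
      ((integrable_fd ha 0).const_mul s)).integrableOn) (hint.const_mul _) measurableSet_Ioi
      fun y hy => ?_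
    have hy' : s < y := hy
    have h1 : s ^ α ≤ y ^ α := Real.rpow_le_rpow hs.le hy'.le ha.le
    have h2 : fd α 0 y = C0 α * Real.exp (-(y ^ α)) := by simp [fd, abs_of_pos (hs.trans hy')]
    have h3 : 0 ≤ (α * (y ^ α - s ^ α)) * ((y - s) * fd α 0 y) :=
      mul_nonneg (mul_nonneg ha.le (sub_nonneg.2 h1))
        (mul_nonneg (sub_nonneg.2 hy'.le) (fd_pos ha 0 y).le)
    rw [h2] at h3 ⊢
    linarith
  rw [integral_const_mul, hzero, mul_zero, integral_sub
    ((integrable_sub_mul_fd ha 0 s).const_mul _).integrableOn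
    ((integrable_fd ha 0).const_mul s).integrableOn, integral_const_mul, integral_const_mul] at hle
  rw [excess, Ptail]
  linarith

lemma mul_excess_le {α : ℝ} (ha : 0 < α) {θ S : ℝ} (hS : θ < S) :
    (α * (S - θ) ^ α - 2) * excess α θ S ≤ (S - θ) * Ptail α θ S := by
  rw [excess_eq_excess_zero_sub, Ptail_eq_Ptail_zero_sub]
  exact mul_excess_zero_le ha (sub_pos.2 hS)

lemma Vfun_eq_div {α : ℝ} (ha : 0 < α) (θ γ s S : ℝ) :
    Vfun α θ γ S = ((∫ y in Ioi S, (y - s) * fd α θ y) + s * Ptail α θ S) /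
      ((1 - γ) + γ * Ptail α θ S) := by
  rw [Vfun, muTail, div_mul_cancel₀ _ (Ptail_pos ha θ S).ne', setIntegral_Ioi_id_mul_fd ha θ s S]

lemma Vfun_denom_pos {α : ℝ} (ha : 0 < α) (θ S : ℝ) {γ : ℝ} (hγ : γ ∈ Ioo (0 : ℝ) 1) :
    0 < (1 - γ) + γ * Ptail α θ S :=
  add_pos (sub_pos.2 hγ.2) (mul_pos hγ.1 (Ptail_pos ha θ S))

lemma Vfun_eq_of_bellman {α θ γ s : ℝ} (ha : 0 < α) (hγ : γ ∈ Ioo (0 : ℝ) 1)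
    (h : (1 - γ) / γ * s = excess α θ s) : Vfun α θ γ s = s / γ := by
  have hd := Vfun_denom_pos ha θ s hγ
  have hγ0 := hγ.1
  rw [Vfun_eq_div ha θ γ s s, ← excess, ← h]
  field_simp

lemma Vfun_le_of_bellman {α θ γ s : ℝ} (ha : 0 < α) (hγ : γ ∈ Ioo (0 : ℝ) 1)
    (h : (1 - γ) / γ * s = excess α θ s) (S : ℝ) : Vfun α θ γ S ≤ s / γ := by
  have hγ0 := hγ.1
  rw [Vfun_eq_div ha θ γ s S, div_le_iff₀ (Vfun_denom_pos ha θ S hγ)]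
  have h1 := setIntegral_Ioi_sub_mul_fd_le_excess ha θ s S
  have h2 : s / γ * ((1 - γ) + γ * Ptail α θ S) = (1 - γ) / γ * s + s * Ptail α θ S := by
    field_simp
  rw [h2, h]
  linarith

lemma mul_Ptail_div_le_Vfun {α γ : ℝ} (ha : 0 < α) (θ S : ℝ) (hγ : γ ∈ Ioo (0 : ℝ) 1) :
    S * Ptail α θ S / ((1 - γ) + γ * Ptail α θ S) ≤ Vfun α θ γ S := by
  rw [Vfun_eq_div ha θ γ S S, ← excess]
  have := excess_pos ha θ S
  exact div_le_div_of_nonneg_right (by linarith) (Vfun_denom_pos ha θ S hγ).le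

lemma sub_le_of_bellman {α δ θ x s t : ℝ} (ha : 0 < α) (hδ : 0 < δ)
    (hs : δ * s = excess α θ s) (ht : δ * t = excess α x t) : t - s ≤ |x - θ| := by
  by_contra! h
  have h1 : excess α x t ≤ excess α θ s := by
    rw [excess_eq_excess_zero_sub α x, excess_eq_excess_zero_sub α θ]
    exact excess_antitone ha 0 (by linarith [le_abs_self (x - θ)])
  have h2 : δ * s < δ * t := mul_lt_mul_of_pos_left (by linarith [abs_nonneg (x - θ)]) hδ
  linarith

lemma abs_sub_le_of_bellman {α δ θ x s t : ℝ} (ha : 0 < α) (hδ : 0 < δ)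
    (hs : δ * s = excess α θ s) (ht : δ * t = excess α x t) : |t - s| ≤ |x - θ| :=
  abs_sub_le_iff.2 ⟨sub_le_of_bellman ha hδ hs ht,
    abs_sub_comm x θ ▸ sub_le_of_bellman ha hδ ht hs⟩

lemma le_Vfun_div_Vfun_of_bellman {α θ x γ s t : ℝ} (ha : 0 < α) (hα1 : α ≤ 1)
    (hγ : γ ∈ Ioo (0 : ℝ) 1) (hs0 : 0 < s) (hs : (1 - γ) / γ * s = excess α θ s)
    (ht : (1 - γ) / γ * t = excess α x t) (ht0 : 0 < t) (hθt : |θ| < t)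
    (hD : 0 < α * (t - θ) ^ α - 2) :
    t / s / (1 + 2 * Real.exp (|x - θ| ^ α) / (α * (t - θ) ^ α - 2)) ≤
      Vfun α θ γ t / Vfun α θ γ s := by
  have hP := Ptail_pos ha θ t
  have hK := Real.exp_pos (|x - θ| ^ α)
  have hγ0 := hγ.1
  have h1 := excess_le_mul_excess ha hα1 θ x t
  have h2 := mul_excess_le ha ((le_abs_self θ).trans_lt hθt)
  rw [← ht] at h1
  have hV := mul_Ptail_div_le_Vfun ha θ t hγ
  have hden := Vfun_denom_pos ha θ t hγ
  rw [Vfun_eq_of_bellman ha hγ hs]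
  set P := Ptail α θ t
  set K := Real.exp (|x - θ| ^ α)
  set D := α * (t - θ) ^ α - 2
  have h3 : (1 - γ) / γ * D ≤ 2 * K * P := by
    refine le_of_mul_le_mul_left ?_ ht0
    have h4 : (t - θ) * P ≤ 2 * t * P :=
      mul_le_mul_of_nonneg_right (by linarith [neg_abs_le θ]) hP.le
    calc t * ((1 - γ) / γ * D) = D * ((1 - γ) / γ * t) := by ring
      _ ≤ D * (K * excess α θ t) := mul_le_mul_of_nonneg_left h1 hD.le
      _ = K * (D * excess α θ t) := by ring
      _ ≤ K * (2 * t * P) := mul_le_mul_of_nonneg_left (h2.trans h4) hK.le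
      _ = t * (2 * K * P) := by ring
  refine le_trans ?_ (div_le_div_of_nonneg_right hV (div_pos hs0 hγ0).le)
  have h5 : t * P / ((1 - γ) + γ * P) / (s / γ) = t / s * (P / ((1 - γ) / γ + P)) := by
    have : 0 < (1 - γ) / γ + P := add_pos (div_pos (sub_pos.2 hγ.2) hγ0) hP
    field_simp
  rw [h5, div_eq_mul_inv (t / s)]
  refine mul_le_mul_of_nonneg_left ?_ (div_pos ht0 hs0).le
  have h6 : (1 - γ) / γ ≤ 2 * K / D * P := by
    rw [div_mul_eq_mul_div, le_div_iff₀ hD]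
    exact h3
  rw [inv_eq_one_div, div_le_div_iff₀ (by positivity)
    (add_pos (div_pos (sub_pos.2 hγ.2) hγ0) hP)]
  linarith

lemma tendsto_atTop_of_bellman {α ϑ : ℝ} (ha : 0 < α) {s : ℝ → ℝ}
    (hs : ∀ γ ∈ Ioo (0 : ℝ) 1, (1 - γ) / γ * s γ = excess α ϑ (s γ)) :
    Tendsto s (𝓝[<] 1) atTop := by
  refine tendsto_atTop.2 fun M => ?_
  have hδ : Tendsto (fun γ : ℝ => (1 - γ) / γ * M) (𝓝[<] 1) (𝓝 0) := by
    have : ContinuousAt (fun γ : ℝ => (1 - γ) / γ * M) 1 := by fun_prop (disch := norm_num)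
    simpa using this.tendsto.mono_left nhdsWithin_le_nhds
  filter_upwards [hδ.eventually_lt_const (excess_pos ha ϑ M), Ioo_mem_nhdsLT zero_lt_one]
    with γ hγM hγ
  by_contra! h
  have h1 := excess_antitone ha ϑ h.le
  have h2 : (1 - γ) / γ * s γ ≤ (1 - γ) / γ * M :=
    mul_le_mul_of_nonneg_left h.le (div_pos (sub_pos.2 hγ.2) hγ.1).le
  linarith [hs γ hγ]

lemma tendsto_Vfun_div_Vfun_of_bellman {α θ x : ℝ} (ha : 0 < α) (hα1 : α ≤ 1) {s t : ℝ → ℝ}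
    (hs : ∀ γ ∈ Ioo (0 : ℝ) 1, (1 - γ) / γ * s γ = excess α θ (s γ))
    (ht : ∀ γ ∈ Ioo (0 : ℝ) 1, (1 - γ) / γ * t γ = excess α x (t γ)) :
    Tendsto (fun γ => Vfun α θ γ (t γ) / Vfun α θ γ (s γ)) (𝓝[<] 1) (𝓝 1) := by
  have hs_top := tendsto_atTop_of_bellman ha hs
  have ht_top := tendsto_atTop_of_bellman ha ht
  have hIoo : Ioo (0 : ℝ) 1 ∈ 𝓝[<] (1 : ℝ) := Ioo_mem_nhdsLT zero_lt_one
  have hD : Tendsto (fun γ => α * (t γ - θ) ^ α - 2) (𝓝[<] 1) atTop :=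
    tendsto_atTop_add_const_right _ _ (((tendsto_rpow_atTop ha).comp
      (tendsto_atTop_add_const_right _ (-θ) ht_top)).const_mul_atTop ha)
  have hratio : Tendsto (fun γ => t γ / s γ) (𝓝[<] 1) (𝓝 1) := by
    have h0 : Tendsto (fun γ => (t γ - s γ) / s γ) (𝓝[<] 1) (𝓝 0) := by
      refine squeeze_zero_norm' ?_ (hs_top.const_div_atTop |x - θ|)
      filter_upwards [hIoo, hs_top.eventually_gt_atTop 0] with γ hγ hs0
      rw [norm_div, Real.norm_of_nonneg hs0.le]
      exact div_le_div_of_nonneg_right (abs_sub_le_of_bellman ha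
        (div_pos (sub_pos.2 hγ.2) hγ.1) (hs γ hγ) (ht γ hγ)) hs0.le
    have h1 := h0.add_const 1
    rw [zero_add] at h1
    refine h1.congr' ?_
    filter_upwards [hs_top.eventually_gt_atTop 0] with γ hs0
    field_simp
    ring
  have hlow := hratio.div ((hD.const_div_atTop (2 * Real.exp (|x - θ| ^ α))).const_add 1)
    (by norm_num)
  simp only [add_zero, div_one] at hlow
  refine tendsto_of_tendsto_of_tendsto_of_le_of_le' hlow tendsto_const_nhds ?_ ?_
  · filter_upwards [hIoo, hs_top.eventually_gt_atTop 0, ht_top.eventually_gt_atTop 0,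
      ht_top.eventually_gt_atTop |θ|, hD.eventually_gt_atTop 0] with γ hγ hs0 ht0 htθ hD0
    exact le_Vfun_div_Vfun_of_bellman ha hα1 hγ hs0 (hs γ hγ) (ht γ hγ) ht0 htθ hD0
  · filter_upwards [hIoo, hs_top.eventually_gt_atTop 0] with γ hγ hs0
    rw [Vfun_eq_of_bellman ha hγ (hs γ hγ)]
    exact div_le_one_of_le₀ (Vfun_le_of_bellman ha hγ (hs γ hγ) _) (div_pos hs0 hγ.1).le

/-- Dominated convergence to zero without measurability: integrals of non-measurable functions
vanish by convention. -/
lemma tendsto_integral_zero_of_dominated {ι Ω : Type*} {mΩ : MeasurableSpace Ω} {μ : Measure Ω}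
    {l : Filter ι} [l.IsCountablyGenerated] {F : ι → Ω → ℝ} (bound : Ω → ℝ)
    (h_bound : ∀ᶠ n in l, ∀ᵐ a ∂μ, ‖F n a‖ ≤ bound a) (bound_integrable : Integrable bound μ)
    (h_lim : ∀ᵐ a ∂μ, Tendsto (fun n => F n a) l (𝓝 0)) :
    Tendsto (fun n => ∫ a, F n a ∂μ) l (𝓝 0) := by
  classical
  let G : ι → Ω → ℝ := fun n => if AEStronglyMeasurable (F n) μ then F n else 0
  have hG : ∀ n a, ‖G n a‖ ≤ ‖F n a‖ := fun n a => by
    by_cases h : AEStronglyMeasurable (F n) μ <;> simp [G, h]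
  have hFG : ∀ n, ∫ a, G n a ∂μ = ∫ a, F n a ∂μ := fun n => by
    by_cases h : AEStronglyMeasurable (F n) μ
    · simp [G, h]
    · simp [G, h, integral_non_aestronglyMeasurable h]
  have hmeas : ∀ n, AEStronglyMeasurable (G n) μ := fun n => by
    by_cases h : AEStronglyMeasurable (F n) μ
    · simp [G, h]
    · simpa [G, h] using aestronglyMeasurable_zero
  have key := tendsto_integral_filter_of_dominated_convergence (F := G) (f := fun _ => 0) bound
    (Eventually.of_forall hmeas)
    (h_bound.mono fun n hn => hn.mono fun a h => (hG n a).trans h) bound_integrable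
    (h_lim.mono fun a h => squeeze_zero_norm (fun n => hG n a) (by simpa using h.norm))
  simpa [hFG] using key

/-- Sufficiency of a single observation for `α ∈ [1/2, 1]`: the single-sample
plug-in relative regret `R₁(θ,γ) = 1 − γ(1 − E_{X∼F_θ}[R(θ,γ,S*(X,γ))])`
tends to `0` as `γ → 1⁻`. -/
theorem stmt_18 (α : ℝ) (hα : 1/2 ≤ α) (hα1 : α ≤ 1) (θ : ℝ)
    (Sstar : ℝ → ℝ → ℝ)
    (hS : ∀ ϑ : ℝ, ∀ γ ∈ Set.Ioo (0:ℝ) 1,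
      0 < Sstar ϑ γ ∧
      ((1-γ)/γ) * Sstar ϑ γ = (∫ x in Set.Ioi (Sstar ϑ γ), Ptail α ϑ x) ∧
      ∀ S, 0 < S → ((1-γ)/γ) * S = (∫ x in Set.Ioi S, Ptail α ϑ x) → S = Sstar ϑ γ)
    (R1 : ℝ → ℝ)
    (hR1 : ∀ γ, R1 γ = 1 - γ *
      (1 - ∫ x, (1 - Vfun α θ γ (Sstar x γ) / Vfun α θ γ (Sstar θ γ))
        ∂(volume.withDensity (fun x => ENNReal.ofReal (fd α θ x))))) :
    Tendsto R1 (𝓝[<] (1:ℝ)) (𝓝 0) := by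
  have ha : 0 < α := by linarith
  have hbell : ∀ ϑ, ∀ γ ∈ Ioo (0 : ℝ) 1,
      (1 - γ) / γ * Sstar ϑ γ = excess α ϑ (Sstar ϑ γ) := fun ϑ γ hγ =>
    (hS ϑ γ hγ).2.1.trans (integral_Ptail_eq_excess ha ϑ _)
  set μ := volume.withDensity fun x => ENNReal.ofReal (fd α θ x)
  have : IsFiniteMeasure μ := isFiniteMeasure_withDensity_ofReal (integrable_fd ha θ).2
  have hint : Tendsto (fun γ => ∫ x, (1 - Vfun α θ γ (Sstar x γ) / Vfun α θ γ (Sstar θ γ)) ∂μ)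
      (𝓝[<] 1) (𝓝 0) := by
    refine tendsto_integral_zero_of_dominated (fun _ => 1) ?_ (integrable_const 1)
      (ae_of_all _ fun x => ?_)
    · filter_upwards [Ioo_mem_nhdsLT (zero_lt_one (α := ℝ))] with γ hγ
      refine ae_of_all _ fun x => ?_
      have hs0 := div_pos (hS θ γ hγ).1 hγ.1
      have h1 : Vfun α θ γ (Sstar x γ) / (Sstar θ γ / γ) ≤ 1 :=
        div_le_one_of_le₀ (Vfun_le_of_bellman ha hγ (hbell θ γ hγ) _) hs0.le
      have h2 : 0 ≤ Vfun α θ γ (Sstar x γ) / (Sstar θ γ / γ) :=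
        div_nonneg ((div_nonneg (mul_nonneg (hS x γ hγ).1.le (Ptail_pos ha θ _).le)
          (Vfun_denom_pos ha θ _ hγ).le).trans (mul_Ptail_div_le_Vfun ha θ _ hγ)) hs0.le
      rw [Vfun_eq_of_bellman ha hγ (hbell θ γ hγ), Real.norm_eq_abs, abs_le]
      constructor <;> linarith
    · simpa using (tendsto_Vfun_div_Vfun_of_bellman ha hα1 (hbell θ) (hbell x)).const_sub 1
  have hid : Tendsto (fun γ : ℝ => γ) (𝓝[<] 1) (𝓝 1) := nhdsWithin_le_nhds
  simpa [funext hR1] using (hid.mul (hint.const_sub 1)).const_sub 1
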